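/- The Gauss hypergeometric series satisfies ₂F₁(1/6, 2/3; 5/6; 16/25) = (2/3) · 5^{1/3}. -/

import Mathlib

open scoped Nat

/-- Pochhammer symbol (rising factorial) on the reals. -/
noncomputable def poch (a : ℝ) (n : ℕ) : ℝ := ∏ i ∈ Finset.range n, (a + i)

/-- Gauss hypergeometric series ₂F₁(a,b;c;x) as a real series. -/
noncomputable def twoFone (a b c x : ℝ) : ℝ :=
  ∑' n : ℕ, poch a n * poch b n / (poch c n * (n ! : ℝ)) * x ^ n

open MeasureTheory Set

theorem poch_succ' (a : ℝ) (n : ℕ) : poch a (n+1) = poch a n * (a + n) := by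
  simp [poch, Finset.prod_range_succ]

theorem poch_pos' {a : ℝ} (ha : 0 < a) (n : ℕ) : 0 < poch a n := by
  unfold poch; exact Finset.prod_pos (fun i _ => by positivity)

noncomputable def gg (v : ℝ) : ℝ := (1 - v^2) ^ (-(2/3) : ℝ)

noncomputable def aa (k : ℕ) : ℝ := poch (1/3) k / (k ! : ℝ)

theorem aa_nonneg (k : ℕ) : 0 ≤ aa k := by
  unfold aa; have := poch_pos' (a := 1/3) (by norm_num) k; positivity

theorem aa_succ (k : ℕ) : aa (k+1) = aa k * ((1/3 + k) / (k+1)) := by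
  unfold aa; rw [poch_succ', Nat.factorial_succ]; push_cast
  have : (k ! : ℝ) ≠ 0 := by positivity
  field_simp

theorem aa_le (k : ℕ) : aa k ≤ 1 := by
  induction k with
  | zero => simp [aa, poch]
  | succ k ih =>
    rw [aa_succ]
    have h1 : (1/3 + (k:ℝ)) / (k+1) ≤ 1 := by rw [div_le_one (by positivity)]; linarith
    have h0 : 0 ≤ (1/3 + (k:ℝ)) / (k+1) := by positivity
    nlinarith [aa_nonneg k]

theorem choose_aux (n : ℕ) : Ring.choose (-(1/3) : ℝ) n * (-1)^n = aa n := by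
  have hd : ∀ n : ℕ, (descPochhammer ℤ n).smeval (-(1/3) : ℝ) * (-1)^n = poch (1/3) n := by
    intro n
    induction n with
    | zero => simp [poch]
    | succ n ih =>
      rw [descPochhammer_succ_right, Polynomial.smeval_mul, Polynomial.smeval_sub,
        Polynomial.smeval_X, Polynomial.smeval_natCast, poch_succ', ← ih]
      simp
      ring
  rw [Ring.choose_eq_smul, aa, ← hd, smul_eq_mul]
  ring

theorem binom_aux {x : ℝ} (hx : |x| < 1) :
    HasSum (fun k => aa k * x^k) ((1 - x) ^ (-(1/3) : ℝ)) := by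
  have h := (Real.one_add_rpow_hasFPowerSeriesOnBall_zero (a := -(1/3))).hasSum (y := -x)
    (by simp [enorm_eq_nnnorm]; rw [← NNReal.coe_lt_coe]; simpa using hx)
  simp only [zero_add] at h
  convert! h using 1
  · ext k
    rw [binomialSeries_apply, ← choose_aux]
    simp
    rw [neg_pow x]; ring
  
theorem gg_int : IntegrableOn gg (Ioo (-1) 1) := by
  have h1 : IntegrableOn (fun v : ℝ => (1 - v) ^ (-(2/3) : ℝ)) (Ioo (-1) 1) := by
    have := (intervalIntegral.intervalIntegrable_rpow' (a := 2) (b := 0) (r := -(2/3)) (by norm_num)).comp_sub_left 1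
    norm_num at this
    rw [intervalIntegrable_iff_integrableOn_Ioo_of_le (by norm_num)] at this
    exact this
  have h2 : IntegrableOn (fun v : ℝ => (1 + v) ^ (-(2/3) : ℝ)) (Ioo (-1) 1) := by
    have := (intervalIntegral.intervalIntegrable_rpow' (a := 0) (b := 2) (r := -(2/3)) (by norm_num)).comp_add_left 1
    norm_num at this
    rw [intervalIntegrable_iff_integrableOn_Ioo_of_le (by norm_num)] at this
    exact this
  refine Integrable.mono' (h1.add h2) ?_ ?_
  · exact (by unfold gg; fun_prop : Measurable gg).aestronglyMeasurable
  · filter_upwards [ae_restrict_mem measurableSet_Ioo] with v hv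
    have p1 : 0 < 1 - v := by linarith [hv.2]
    have p2 : 0 < 1 + v := by linarith [hv.1]
    have e : gg v = (1 - v) ^ (-(2/3) : ℝ) * (1 + v) ^ (-(2/3) : ℝ) := by
      rw [← Real.mul_rpow p1.le p2.le, gg]; ring_nf
    have q1 := Real.rpow_pos_of_pos p1 (-(2/3) : ℝ)
    have q2 := Real.rpow_pos_of_pos p2 (-(2/3) : ℝ)
    rw [Real.norm_of_nonneg (by rw [e]; positivity), e]
    simp only [Pi.add_apply]
    rcases le_total v 0 with h | h
    · have : (1 - v) ^ (-(2/3) : ℝ) ≤ 1 := Real.rpow_le_one_of_one_le_of_nonpos (by linarith) (by norm_num)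
      nlinarith
    · have : (1 + v) ^ (-(2/3) : ℝ) ≤ 1 := Real.rpow_le_one_of_one_le_of_nonpos (by linarith) (by norm_num)
      nlinarith

theorem gg_pos {v : ℝ} (hv : v ∈ Ioo (-1 : ℝ) 1) : 0 < gg v := by
  unfold gg; apply Real.rpow_pos_of_pos; nlinarith [hv.1, hv.2]

theorem pow_int {h : ℝ → ℝ} (hh : IntegrableOn h (Ioo (-1) 1)) (k : ℕ) :
    IntegrableOn (fun v => v^k * h v) (Ioo (-1) 1) := by
  refine Integrable.mono' hh.norm ?_ ?_
  · exact (by fun_prop : Measurable (fun v : ℝ => v^k)).aestronglyMeasurable.mul hh.1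
  · filter_upwards [ae_restrict_mem measurableSet_Ioo] with v hv
    rw [norm_mul, norm_pow]
    have : ‖v‖ ^ k ≤ 1 := pow_le_one₀ (norm_nonneg _) (by rw [Real.norm_eq_abs, abs_le]; exact ⟨hv.1.le, hv.2.le⟩)
    nlinarith [norm_nonneg (h v)]

noncomputable def mm (k : ℕ) : ℝ := ∫ v in Ioo (-1 : ℝ) 1, v^k * gg v

theorem mm_zero_pos : 0 < mm 0 := by
  unfold mm
  rw [setIntegral_pos_iff_support_of_nonneg_ae]
  · have : Ioo (-1 : ℝ) 1 ⊆ (Function.support fun v : ℝ => v^0 * gg v) ∩ Ioo (-1) 1 := by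
      intro v hv
      exact ⟨by simpa using (gg_pos hv).ne', hv⟩
    refine lt_of_lt_of_le ?_ (measure_mono this)
    simp
  · filter_upwards [ae_restrict_mem measurableSet_Ioo] with v hv
    simpa using (gg_pos hv).le
  · exact pow_int gg_int 0

theorem gg_deriv {v : ℝ} (hv : v ∈ Ioo (-1 : ℝ) 1) :
    HasDerivAt (fun v : ℝ => (1 - v^2) ^ ((1/3) : ℝ)) (-(2/3) * (v * gg v)) v := by
  have p : 0 < 1 - v^2 := by nlinarith [hv.1, hv.2]
  have h1 : HasDerivAt (fun v : ℝ => 1 - v^2) (-(2*v)) v := by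
    simpa using ((hasDerivAt_id v).pow 2).const_sub 1
  convert! h1.rpow_const (p := 1/3) (Or.inl p.ne') using 1
  unfold gg
  norm_num
  ring

theorem cube_cont : Continuous (fun v : ℝ => (1 - v^2) ^ ((1/3) : ℝ)) := by
  apply Continuous.rpow_const (by fun_prop)
  intro x; right; norm_num

theorem ftc_aux {f f' : ℝ → ℝ} (hf : Continuous f) (hd : ∀ v ∈ Ioo (-1:ℝ) 1, HasDerivAt f (f' v) v)
    (hi : IntegrableOn f' (Ioo (-1) 1)) (h1 : f 1 = 0) (h2 : f (-1) = 0) :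
    ∫ v in Ioo (-1:ℝ) 1, f' v = 0 := by
  have := intervalIntegral.integral_eq_sub_of_hasDerivAt_of_le (a := -1) (b := 1) (by norm_num)
    hf.continuousOn hd ((intervalIntegrable_iff_integrableOn_Ioo_of_le (by norm_num)).2 hi)
  rw [intervalIntegral.integral_of_le (by norm_num), integral_Ioc_eq_integral_Ioo, h1, h2] at this
  simpa using this

theorem mm_one : mm 1 = 0 := by
  have h := ftc_aux cube_cont (fun v hv => gg_deriv hv)
    (by have := (pow_int gg_int 1).const_mul (-(2/3)); simpa [IntegrableOn] using this) (by norm_num) (by norm_num)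
  rw [integral_const_mul] at h
  unfold mm
  simpa using h

theorem mm_succ (k : ℕ) : mm (k+2) * (k + 5/3) = (k+1) * mm k := by
  have i1 := (pow_int gg_int k).const_mul ((k:ℝ)+1)
  have i2 := (pow_int gg_int (k+2)).const_mul ((k:ℝ)+5/3)
  have h := ftc_aux (f := fun v => v^(k+1) * (1 - v^2) ^ ((1/3) : ℝ))
    (f' := fun v => ((k:ℝ)+1) * (v^k * gg v) - ((k:ℝ)+5/3) * (v^(k+2) * gg v))
    ((continuous_pow _).mul cube_cont) ?_ (i1.sub i2) (by norm_num) (by norm_num)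
  · rw [integral_sub i1 i2, integral_const_mul, integral_const_mul] at h
    unfold mm; linarith
  · intro v hv
    have p : 0 < 1 - v^2 := by nlinarith [hv.1, hv.2]
    convert! (hasDerivAt_pow (k+1) v).mul (gg_deriv hv) using 1
    have : (1 - v^2) ^ ((1/3) : ℝ) = (1 - v^2) * gg v := by
      unfold gg
      nth_rewrite 2 [← Real.rpow_one (1 - v^2)]
      rw [← Real.rpow_add p]; norm_num
    rw [this]; push_cast; ring

theorem mm_odd (n : ℕ) : mm (2*n+1) = 0 := by
  induction n with
  | zero => exact mm_one
  | succ n ih =>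
    have := mm_succ (2*n+1)
    rw [ih, mul_zero] at this
    have h : (((2*n+1:ℕ):ℝ) + 5/3) ≠ 0 := by positivity
    exact (mul_eq_zero.1 this).resolve_right h

theorem mm_even (n : ℕ) : aa (2*n) * mm (2*n) =
    poch (1/6) n * poch (2/3) n / (poch (5/6) n * (n ! : ℝ)) * mm 0 := by
  induction n with
  | zero => simp [aa, poch]
  | succ n ih =>
    have h := mm_succ (2*n)
    have e : mm (2*n+2) = (2*n+1) * mm (2*n) / (2*n+5/3) := by
      rw [eq_div_iff (by positivity)]; exact_mod_cast h
    have hp := (poch_pos' (a := 5/6) (by norm_num) n).ne'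
    have hf : (n ! : ℝ) ≠ 0 := by positivity
    rw [show 2*(n+1) = 2*n+1+1 by ring, aa_succ, aa_succ, poch_succ', poch_succ', poch_succ',
      Nat.factorial_succ, show 2*n+1+1 = 2*n+2 by ring, e]
    push_cast
    calc _ = (aa (2*n) * mm (2*n)) * ((1/3 + 2*n)/(2*n+1) * ((1/3+(2*n+1))/(2*n+1+1)) * ((2*n+1)/(2*n+5/3))) := by ring
      _ = _ := by rw [ih]; field_simp; ring

noncomputable def psi (v : ℝ) : ℝ := gg v * (1 - 4/5*v) ^ (-(1/3) : ℝ)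

theorem series_int : HasSum (fun k => aa k * (4/5)^k * mm k) (∫ v in Ioo (-1:ℝ) 1, psi v) := by
  have hb : ∀ k, aa k * (4/5 : ℝ)^k ≤ (4/5 : ℝ)^k := fun k => by
    have := aa_le k; have : (0:ℝ) < (4/5)^k := by positivity
    nlinarith
  have h0 : ∀ k, 0 ≤ aa k * (4/5 : ℝ)^k := fun k => mul_nonneg (aa_nonneg k) (by positivity)
  have h := hasSum_integral_of_summable_integral_norm (μ := volume.restrict (Ioo (-1:ℝ) 1))
    (F := fun (k : ℕ) v => aa k * (4/5)^k * (v^k * gg v)) (fun k => (pow_int gg_int k).const_mul _) ?_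
  · convert! h using 1
    · ext k; rw [integral_const_mul]; rfl
    · apply setIntegral_congr_fun measurableSet_Ioo
      intro v hv
      have hv' : |4/5*v| < 1 := by rw [abs_lt]; constructor <;> linarith [hv.1, hv.2]
      have := ((binom_aux hv').mul_left (gg v)).tsum_eq
      simp only [psi]
      rw [← this]
      congr 1; ext k; rw [mul_pow]; ring
  · refine Summable.of_nonneg_of_le (fun k => integral_nonneg fun v => norm_nonneg _) (fun k => ?_)
      ((summable_geometric_of_lt_one (r := (4/5:ℝ)) (by norm_num) (by norm_num)).mul_right (∫ v in Ioo (-1:ℝ) 1, gg v))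
    rw [← integral_const_mul]
    apply setIntegral_mono_on ((pow_int gg_int k).const_mul _).norm (gg_int.const_mul _) measurableSet_Ioo
    intro v hv
    have g0 := gg_pos hv
    rw [norm_mul, Real.norm_of_nonneg (h0 k), norm_mul, norm_pow, Real.norm_of_nonneg g0.le]
    have : ‖v‖ ^ k ≤ 1 := pow_le_one₀ (norm_nonneg _) (by rw [Real.norm_eq_abs, abs_le]; exact ⟨hv.1.le, hv.2.le⟩)
    have h3 : ‖v‖ ^ k * gg v ≤ gg v := by nlinarith
    exact mul_le_mul (hb k) h3 (by positivity) (by positivity)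

theorem euler : twoFone (1/6) (2/3) (5/6) (16/25) * mm 0 = ∫ v in Ioo (-1:ℝ) 1, psi v := by
  have h := series_int
  rw [← (mul_right_injective₀ (two_ne_zero (α := ℕ))).hasSum_iff] at h
  · rw [← h.tsum_eq, twoFone, ← tsum_mul_right]
    congr 1; ext n
    simp only [Function.comp]
    rw [show aa (2*n) * (4/5:ℝ)^(2*n) * mm (2*n) = (aa (2*n) * mm (2*n)) * (4/5:ℝ)^(2*n) by ring,
      mm_even, pow_mul]
    norm_num
    ring
  · intro k hk
    rcases Nat.even_or_odd' k with ⟨c, rfl | rfl⟩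
    · exact absurd ⟨c, rfl⟩ hk
    · rw [mm_odd, mul_zero]

theorem psi_int : IntegrableOn psi (Ioo (-1) 1) := by
  refine Integrable.mono' (gg_int.const_mul ((1/5:ℝ) ^ (-(1/3) : ℝ))) ?_ ?_
  · exact (by unfold psi gg; fun_prop : Measurable psi).aestronglyMeasurable
  · filter_upwards [ae_restrict_mem measurableSet_Ioo] with v hv
    have g0 := gg_pos hv
    have p : 0 < 1 - 4/5*v := by linarith [hv.2]
    have q := Real.rpow_pos_of_pos p (-(1/3) : ℝ)
    rw [psi, norm_mul, Real.norm_of_nonneg g0.le, Real.norm_of_nonneg q.le, mul_comm]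
    gcongr ?_ * _
    apply Real.rpow_le_rpow_of_nonpos (by norm_num) (by linarith [hv.2]) (by norm_num)

theorem cube_rpow {x : ℝ} (hx : 0 < x) (n : ℕ) : (x ^ (-((n:ℝ)/3))) ^ 3 = (x ^ n)⁻¹ := by
  rw [← Real.rpow_natCast, ← Real.rpow_mul hx.le]
  norm_num

theorem subst_aux {a b : ℝ} (hab : a < b) (ha : -1 ≤ a) (hb : b ≤ 1) {f f' : ℝ → ℝ}
    (hc : ContinuousOn f (Icc a b)) (hd : ∀ v ∈ Ioo a b, HasDerivAt f (f' v) v)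
    (hpos : ∀ v ∈ Ioo a b, 0 < f' v) (fa : f a = -1) (fb : f b = 1)
    (hid : ∀ v ∈ Ioo a b, (f' v)^3 * ((1 - v^2)^2 * (1 - 4/5*v)) = 27/5 * (1 - (f v)^2)^2) :
    mm 0 = 3 / 5 ^ ((1:ℝ)/3) * ∫ v in Ioo a b, psi v := by
  have mono : StrictMonoOn f (Icc a b) := by
    apply strictMonoOn_of_deriv_pos (convex_Icc a b) hc
    intro v hv
    rw [interior_Icc] at hv
    rw [(hd v hv).deriv]; exact hpos v hv
  have hmaps : ∀ v ∈ Ioo a b, f v ∈ Ioo (-1:ℝ) 1 := fun v hv => by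
    constructor
    · rw [← fa]; exact mono (left_mem_Icc.2 hab.le) (Ioo_subset_Icc_self hv) hv.1
    · rw [← fb]; exact mono (Ioo_subset_Icc_self hv) (right_mem_Icc.2 hab.le) hv.2
  have him : f '' Ioo a b = Ioo (-1) 1 := by
    apply Subset.antisymm
    · rintro _ ⟨v, hv, rfl⟩; exact hmaps v hv
    · have := intermediate_value_Ioo hab.le hc
      rwa [fa, fb] at this
  have h := integral_image_eq_integral_abs_deriv_smul (measurableSet_Ioo (a := a) (b := b))
    (fun v hv => (hd v hv).hasDerivWithinAt) (mono.injOn.mono Ioo_subset_Icc_self) gg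
  rw [him] at h
  have : mm 0 = ∫ v in Ioo (-1:ℝ) 1, gg v := by simp [mm]
  rw [this, h, ← integral_const_mul]
  apply setIntegral_congr_fun measurableSet_Ioo
  intro v hv
  have hv' : v ∈ Ioo (-1:ℝ) 1 := ⟨by linarith [hv.1], by linarith [hv.2]⟩
  have hf := hmaps v hv
  have p1 : 0 < 1 - v^2 := by nlinarith [hv'.1, hv'.2]
  have p2 : 0 < 1 - (f v)^2 := by nlinarith [hf.1, hf.2]
  have p3 : 0 < 1 - 4/5*v := by linarith [hv'.2]
  have p4 := hpos v hv
  simp only [smul_eq_mul]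
  rw [abs_of_pos p4]
  have g1 := gg_pos hv'
  have g2 := gg_pos hf
  have q := Real.rpow_pos_of_pos p3 (-(1/3) : ℝ)
  have r := Real.rpow_pos_of_pos (show (0:ℝ) < 5 by norm_num) (1/3)
  have c1 : gg v ^ 3 = ((1 - v^2)^2)⁻¹ := by
    have := cube_rpow p1 2; norm_num at this; simpa [gg] using this
  have c2 : gg (f v) ^ 3 = ((1 - (f v)^2)^2)⁻¹ := by
    have := cube_rpow p2 2; norm_num at this; simpa [gg] using this
  have c3 : ((1 - 4/5*v) ^ (-(1/3) : ℝ))^3 = (1 - 4/5*v)⁻¹ := by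
    have := cube_rpow p3 1; norm_num at this; simpa using this
  have c4 : ((5:ℝ) ^ ((1:ℝ)/3))^3 = 5 := by
    rw [← Real.rpow_natCast, ← Real.rpow_mul (by norm_num)]; norm_num
  rw [← pow_left_inj₀ (n := 3) (by positivity) (by unfold psi; positivity) (by norm_num)]
  rw [psi, mul_pow, mul_pow, mul_pow, div_pow, c1, c2, c3, c4]
  have := hid v hv
  rw [← div_eq_mul_inv, div_eq_iff (by positivity)]
  have e : f' v ^ 3 = 27/5 * (1 - (f v)^2)^2 / ((1 - v^2)^2 * (1 - 4/5*v)) := by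
    rw [eq_div_iff (by positivity)]; exact this
  rw [e, div_eq_mul_inv, mul_inv]; ring

theorem piece1 : mm 0 = 3 / 5 ^ ((1:ℝ)/3) * ∫ v in Ioo (-1:ℝ) (1/2), psi v := by
  refine subst_aux (f := fun v => 1 - 2 * (16/27*(1/2-v)^3/(1-v)))
    (f' := fun v => 64/27*(1/2-v)^2*(5/4-v)/(1-v)^2) (by norm_num) le_rfl (by norm_num) ?_ ?_ ?_ (by norm_num) (by norm_num) ?_
  · apply ContinuousOn.sub continuousOn_const
    apply ContinuousOn.mul continuousOn_const
    apply ContinuousOn.div (by fun_prop) (by fun_prop)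
    intro v hv; linarith [hv.2]
  · intro v hv
    have p : 1 - v ≠ 0 := by linarith [hv.2]
    have h1 : HasDerivAt (fun v : ℝ => 1/2 - v) (-1) v := (hasDerivAt_id v).const_sub _
    have h2 : HasDerivAt (fun v : ℝ => 1 - v) (-1) v := (hasDerivAt_id v).const_sub _
    convert! ((((h1.pow 3).const_mul (16/27)).div h2 p).const_mul 2).const_sub 1 using 1
    simp
    field_simp
    ring
  · intro v hv
    have : 0 < 1/2 - v := by linarith [hv.2]
    have : 0 < 5/4 - v := by linarith [hv.2]
    have : 0 < 1 - v := by linarith [hv.2]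
    positivity
  · intro v hv
    have p : 1 - v ≠ 0 := by linarith [hv.2]
    field_simp
    ring

theorem piece2 : mm 0 = 3 / 5 ^ ((1:ℝ)/3) * ∫ v in Ioo (1/2:ℝ) 1, psi v := by
  refine subst_aux (f := fun v => 2 * ((v-1/2)^3/((1+v)*(5/4-v)^2)) - 1)
    (f' := fun v => 27/4*(v-1/2)^2/((1+v)^2*(5/4-v)^3)) (by norm_num) (by norm_num) le_rfl ?_ ?_ ?_ (by norm_num) (by norm_num) ?_
  · apply ContinuousOn.sub _ continuousOn_const
    apply ContinuousOn.mul continuousOn_const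
    apply ContinuousOn.div (by fun_prop) (by fun_prop)
    intro v hv
    have : 0 < 5/4 - v := by linarith [hv.2]
    have : 0 < 1 + v := by linarith [hv.1]
    positivity
  · intro v hv
    have p1 : 0 < 5/4 - v := by linarith [hv.2]
    have p4 : 5 - v*4 ≠ 0 := by linarith [hv.2]
    have p5 : 5 - 4*v ≠ 0 := by linarith [hv.2]
    have p2 : 0 < 1 + v := by linarith [hv.1]
    have h1 : HasDerivAt (fun v : ℝ => v - 1/2) 1 v := (hasDerivAt_id v).sub_const _
    have h2 : HasDerivAt (fun v : ℝ => 1 + v) 1 v := (hasDerivAt_id v).const_add _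
    have h3 : HasDerivAt (fun v : ℝ => 5/4 - v) (-1) v := (hasDerivAt_id v).const_sub _
    convert! (((h1.pow 3).div (h2.mul (h3.pow 2)) (by simp; constructor <;> positivity)).const_mul 2).sub_const 1 using 1
    simp
    field_simp
    ring
  · intro v hv
    have : 0 < v - 1/2 := by linarith [hv.1]
    have : 0 < 5/4 - v := by linarith [hv.2]
    have : 0 < 1 + v := by linarith [hv.1]
    positivity
  · intro v hv
    have p1 : 5/4 - v ≠ 0 := by linarith [hv.2]
    have p2 : 1 + v ≠ 0 := by linarith [hv.1]
    have p3 : 5 - 4*v ≠ 0 := by linarith [hv.2]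
    have p4 : 5 - v*4 ≠ 0 := by linarith [hv.2]
    field_simp
    ring

theorem stmt7 : twoFone (1/6) (2/3) (5/6) (16/25) = (2/3) * (5:ℝ) ^ ((1:ℝ)/3) := by
  have hJ : ∫ v in Ioo (-1:ℝ) 1, psi v = (∫ v in Ioo (-1:ℝ) (1/2), psi v) + ∫ v in Ioo (1/2:ℝ) 1, psi v := by
    have i : IntegrableOn psi (Ioc (-1) 1) := (integrableOn_Ioc_iff_integrableOn_Ioo).2 psi_int
    simp only [← integral_Ioc_eq_integral_Ioo]
    rw [← setIntegral_union (Ioc_disjoint_Ioc_of_le le_rfl) measurableSet_Ioc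
      (i.mono_set (Ioc_subset_Ioc le_rfl (by norm_num))) (i.mono_set (Ioc_subset_Ioc (by norm_num) le_rfl)),
      Ioc_union_Ioc_eq_Ioc (by norm_num) (by norm_num)]
  have h1 := piece1
  have h2 := piece2
  have e := euler
  have r := Real.rpow_pos_of_pos (show (0:ℝ) < 5 by norm_num) (1/3)
  have hm := mm_zero_pos
  rw [hJ] at e
  apply mul_right_cancel₀ hm.ne'
  rw [e]
  field_simp at h1 h2 ⊢
  linarith
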